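/- arXiv:2101.03736 — 3 statements merged into one kernel-verified Lean document; each statement's English description precedes it below -/
import Mathlib

section
/- In an add-only attribute system with initial state S, if some plan reaches the state T, then there exists a plan of length at most |T \ S| that also reaches T and in which every rule application strictly enlarges the current state (i.e., each applied rule's target is not already in the state at the moment of application). -/
/-- A rule of an add-only attribute system: a target item, a positive
precondition set and a negative precondition set. -/
structure Rule (α : Type*) where
  tgt : α
  pos : Finset α
  neg : Finset α

variable {α : Type*} [DecidableEq α]

/-- A rule is applicable in a state `T` if its positive preconditions are
contained in `T` and its negative preconditions are disjoint from `T`. -/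
def Applicable (r : Rule α) (T : Finset α) : Prop :=
  r.pos ⊆ T ∧ r.neg ∩ T = ∅

/-- Applying a rule adds its target to the state. -/
def applyRule (r : Rule α) (T : Finset α) : Finset α :=
  insert r.tgt T

/-- The state obtained from `S` after applying the rules of `plan` in order. -/
def runPlan (S : Finset α) (plan : List (Rule α)) : Finset α :=
  plan.foldl (fun T r => applyRule r T) S

/-- A valid plan from a state: each rule belongs to the rule set `R` and is
applicable in the state obtained by applying the previous rules. -/
def IsPlan (R : Set (Rule α)) : Finset α → List (Rule α) → Prop
  | _, [] => True
  | T, r :: rs => r ∈ R ∧ Applicable r T ∧ IsPlan R (applyRule r T) rs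

/-- `SR_d` restriction: at most one rule per target. -/
def SRd (R : Set (Rule α)) : Prop :=
  ∀ r ∈ R, ∀ r' ∈ R, r.tgt = r'.tgt → r = r'

/-- The required set of a goal `G`: the least set containing `G \ S` and
closed under taking positive preconditions (outside `S`) of rules whose
target is required. -/
inductive Required (R : Set (Rule α)) (S G : Finset α) : α → Prop
  | base (a : α) : a ∈ G → a ∉ S → Required R S G a
  | step (r : Rule α) (b : α) : r ∈ R → Required R S G r.tgt →
      b ∈ r.pos → b ∉ S → Required R S G b

/-- Edge of the precedence digraph: `a` must be added strictly before `b`. -/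
def Edge (R : Set (Rule α)) (a b : α) : Prop :=
  a ≠ b ∧ ∃ ra ∈ R, ra.tgt = a ∧ ∃ rb ∈ R, rb.tgt = b ∧
    (a ∈ rb.pos ∨ b ∈ ra.neg)

/-- The precedence digraph restricted to a vertex set `V` contains a
directed cycle. -/
def HasCycleOn (R : Set (Rule α)) (V : Set α) : Prop :=
  ∃ (a : α) (l : List α), (∀ x ∈ a :: l, x ∈ V) ∧ List.Chain (Edge R) a (l ++ [a])

theorem subset_runPlan (S : Finset α) (plan : List (Rule α)) : S ⊆ runPlan S plan := by
  induction plan generalizing S with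
  | nil => exact Finset.Subset.refl S
  | cons r rs ih => exact (Finset.subset_insert r.tgt S).trans (ih (applyRule r S))

/-- Any reachable state `T` is reachable by a plan of length at
most `|T \ S|` in which every rule application strictly enlarges the state. -/
theorem stmt2 (R : Set (Rule α)) (S T : Finset α) (plan : List (Rule α))
    (hplan : IsPlan R S plan) (hreach : runPlan S plan = T) :
    ∃ plan' : List (Rule α), IsPlan R S plan' ∧ runPlan S plan' = T ∧
      plan'.length ≤ (T \ S).card ∧
      ∀ (i : ℕ) (hi : i < plan'.length),
        (plan'.get ⟨i, hi⟩).tgt ∉ runPlan S (plan'.take i) := by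
  induction plan generalizing S with
  | nil =>
    exact ⟨[], trivial, hreach, Nat.zero_le _, fun i hi => absurd hi (Nat.not_lt_zero i)⟩
  | cons r rs ih =>
    obtain ⟨hr, happ, hrs⟩ := hplan
    obtain ⟨p, hp, hpT, hlen, hstrict⟩ := ih (applyRule r S) hrs hreach
    by_cases hmem : r.tgt ∈ S
    · rw [applyRule, Finset.insert_eq_of_mem hmem] at hp hpT hlen hstrict
      exact ⟨p, hp, hpT, hlen, hstrict⟩
    · refine ⟨r :: p, ⟨hr, happ, hp⟩, hpT, ?_, ?_⟩
      · have hT : r.tgt ∈ T := by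
          rw [← hpT]
          exact subset_runPlan _ p (Finset.mem_insert_self r.tgt S)
        have hlt : (T \ applyRule r S).card < (T \ S).card := by
          rw [applyRule, Finset.sdiff_insert]
          exact Finset.card_erase_lt_of_mem (Finset.mem_sdiff.mpr ⟨hT, hmem⟩)
        exact Nat.succ_le_of_lt (hlen.trans_lt hlt)
      · rintro (_ | i) hi
        · exact hmem
        · exact hstrict i (Nat.lt_of_succ_lt_succ hi)
end

section
/- In an add-only attribute system satisfying SR_d with initial state S, if some plan reaches a state T ⊇ G, then for every item a ∈ T \ S (in particular for every a ∈ G \ S) the unique rule r_a with target a satisfies neg(r_a) ∩ S = ∅. -/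
variable {α : Type*} [DecidableEq α]

/-- Every item that a plan adds to `S` is the target of a rule in `R` whose negative
preconditions are disjoint from `S`. -/
theorem IsPlan.exists_rule_of_mem_runPlan {R : Set (Rule α)} {S : Finset α}
    {plan : List (Rule α)} (hplan : IsPlan R S plan) {a : α} (ha : a ∈ runPlan S plan)
    (haS : a ∉ S) : ∃ r ∈ R, r.tgt = a ∧ r.neg ∩ S = ∅ := by
  induction plan generalizing S with
  | nil => exact absurd ha haS
  | cons r rs ih =>
    obtain ⟨hr, happ, hrs⟩ := hplan
    by_cases h : r.tgt = a
    · exact ⟨r, hr, h, happ.2⟩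
    · have haS' : a ∉ applyRule r S := by
        simp [applyRule, haS, Ne.symm h]
      obtain ⟨r', hr', htgt, hneg⟩ := ih hrs ha haS'
      refine ⟨r', hr', htgt, Finset.subset_empty.mp ?_⟩
      rw [← hneg]
      exact Finset.inter_subset_inter_left (Finset.subset_insert _ _)

/-- Under `SR_d`, if some plan reaches a state `T ⊇ G`, then for
every `a ∈ T \ S` (in particular for every `a ∈ G \ S`) the unique rule with
target `a` exists and its negative preconditions are disjoint from `S`. -/
theorem stmt6 (R : Set (Rule α)) (hSR : SRd R) (S G T : Finset α)
    (plan : List (Rule α)) (hplan : IsPlan R S plan)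
    (hreach : runPlan S plan = T) (hGT : G ⊆ T) :
    (∀ a ∈ T, a ∉ S → ∃ r ∈ R, r.tgt = a ∧ r.neg ∩ S = ∅) ∧
    (∀ a ∈ G, a ∉ S → ∃ r ∈ R, r.tgt = a ∧ r.neg ∩ S = ∅) := by
  subst hreach
  exact ⟨fun _ ha haS => hplan.exists_rule_of_mem_runPlan ha haS,
    fun _ ha haS => hplan.exists_rule_of_mem_runPlan (hGT ha) haS⟩
end

section
/- In an add-only attribute system satisfying SR_d with initial state S, suppose some plan reaches a state T, and let a, b ∈ T \ S be distinct items. If a ∈ pos(r_b) or b ∈ neg(r_a), then in every plan reaching T the (first effective) application of the rule r_a occurs strictly before the application of the rule r_b. Consequently, if the precedence digraph on T \ S contains a directed cycle, then no plan reaches T. -/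
variable {α : Type*} [DecidableEq α]

theorem runPlan_take_mono (S : Finset α) (plan : List (Rule α)) :
    Monotone fun i => runPlan S (plan.take i) := by
  refine monotone_nat_of_le_succ fun i => ?_
  rw [List.take_add_one]
  unfold runPlan
  rw [List.foldl_append]
  exact subset_runPlan _ _

/-- A step that changes the state applies a rule whose target is the only new item. -/
theorem IsPlan.exists_rule_of_new {R : Set (Rule α)} {S : Finset α} {plan : List (Rule α)}
    (h : IsPlan R S plan) {x : α} {i : ℕ} (hx : x ∈ runPlan S (plan.take (i + 1)))
    (hx' : x ∉ runPlan S (plan.take i)) :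
    ∃ r ∈ R, r.tgt = x ∧ Applicable r (runPlan S (plan.take i)) ∧
      runPlan S (plan.take (i + 1)) = insert x (runPlan S (plan.take i)) := by
  induction plan generalizing S i with
  | nil => exact absurd (by simpa using hx) hx'
  | cons r rs ih =>
    obtain ⟨hr, happ, hrs⟩ := h
    cases i with
    | zero =>
      have hrx : r.tgt = x := by
        simp only [runPlan, applyRule, List.take_succ_cons, List.take_zero, List.foldl_cons,
          List.foldl_nil, Finset.mem_insert] at hx hx'
        exact (hx.resolve_right hx').symm
      exact ⟨r, hr, hrx, happ, by simp [runPlan, applyRule, hrx]⟩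
    | succ i => exact ih hrs hx hx'

theorem exists_step_of_mem_runPlan {S : Finset α} {plan : List (Rule α)} {x : α}
    (hx : x ∈ runPlan S plan) (hxS : x ∉ S) :
    ∃ i, x ∈ runPlan S (plan.take (i + 1)) ∧ x ∉ runPlan S (plan.take i) := by
  by_contra! h
  have hnot : ∀ i, x ∉ runPlan S (plan.take i) := by
    intro i
    induction i with
    | zero => exact hxS
    | succ i ih => exact fun hi => ih (h i hi)
  exact hnot plan.length (by rwa [List.take_length])

theorem IsPlan.lt_of_precedence {R : Set (Rule α)} (hSR : SRd R) {S : Finset α}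
    {plan : List (Rule α)} (h : IsPlan R S plan) {ra rb : Rule α} (hne : ra.tgt ≠ rb.tgt)
    (hra : ra ∈ R) (hrb : rb ∈ R) (hab : ra.tgt ∈ rb.pos ∨ rb.tgt ∈ ra.neg) {i j : ℕ}
    (hi : ra.tgt ∈ runPlan S (plan.take (i + 1))) (hi' : ra.tgt ∉ runPlan S (plan.take i))
    (hj : rb.tgt ∈ runPlan S (plan.take (j + 1))) (hj' : rb.tgt ∉ runPlan S (plan.take j)) :
    i < j := by
  have hmono := runPlan_take_mono S plan
  obtain ⟨r, hr, hrt, happ, hnew⟩ := h.exists_rule_of_new hi hi'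
  obtain ⟨r', hr', hrt', happ', -⟩ := h.exists_rule_of_new hj hj'
  obtain rfl := hSR r hr ra hra hrt
  obtain rfl := hSR r' hr' rb hrb hrt'
  by_contra! hji
  rcases hab with hpos | hneg
  · exact hi' (hmono hji (happ'.1 hpos))
  · have hb : r'.tgt ∈ runPlan S (plan.take (i + 1)) := hmono (Nat.succ_le_succ hji) hj
    rw [hnew, Finset.mem_insert] at hb
    have hbi := hb.resolve_left hne.symm
    have hmem := Finset.mem_inter.2 ⟨hneg, hbi⟩
    rw [happ.2] at hmem
    exact absurd hmem (Finset.notMem_empty _)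

/-- A function strictly increasing along the edges inside `V` rules out directed cycles on `V`. -/
theorem not_hasCycleOn_of_lt {α : Type*} {R : Set (Rule α)} {V : Set α} (f : α → ℕ)
    (hf : ∀ x ∈ V, ∀ y ∈ V, Edge R x y → f x < f y) : ¬ HasCycleOn R V := by
  rintro ⟨a, l, hV, hc⟩
  have hlt : ∀ (l : List α) (x : α), (∀ y ∈ x :: l, y ∈ V) → a ∈ V →
      List.IsChain (Edge R) (x :: (l ++ [a])) → f x < f a := by
    intro l
    induction l with
    | nil =>
      intro x hx ha hc
      exact hf x (hx x (by simp)) a ha (by simpa using hc)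
    | cons y l ih =>
      intro x hx ha hc
      rw [List.cons_append, List.isChain_cons_cons] at hc
      exact (hf x (hx x (by simp)) y (hx y (by simp)) hc.1).trans
        (ih y (fun z hz => hx z (List.mem_cons_of_mem x hz)) ha hc.2)
  exact lt_irrefl _ (hlt l a hV (hV a (by simp)) hc)

/-- Under `SR_d`, for distinct `a, b ∈ T \ S` with an edge from
`a` to `b` in the precedence digraph (`a ∈ pos(r_b)` or `b ∈ neg(r_a)`), in
every plan reaching `T` the step that first adds `a` occurs strictly before
the step that first adds `b`. Consequently, if the precedence digraph on
`T \ S` has a directed cycle, no plan reaches `T`. -/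
theorem stmt8 (R : Set (Rule α)) (hSR : SRd R) (S T : Finset α) :
    (∀ plan : List (Rule α), IsPlan R S plan → runPlan S plan = T →
      ∀ a b : α, a ∈ T → a ∉ S → b ∈ T → b ∉ S → a ≠ b →
      ∀ ra ∈ R, ra.tgt = a → ∀ rb ∈ R, rb.tgt = b →
      (a ∈ rb.pos ∨ b ∈ ra.neg) →
      ∀ i j : ℕ,
        a ∈ runPlan S (plan.take (i + 1)) → a ∉ runPlan S (plan.take i) →
        b ∈ runPlan S (plan.take (j + 1)) → b ∉ runPlan S (plan.take j) →
        i < j) ∧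
    (HasCycleOn R {x : α | x ∈ T ∧ x ∉ S} →
      ¬ ∃ plan : List (Rule α), IsPlan R S plan ∧ runPlan S plan = T) := by
  refine ⟨?_, ?_⟩
  · rintro plan hplan - a b - - - - hne ra hra rfl rb hrb rfl hab i j hi hi' hj hj'
    exact hplan.lt_of_precedence hSR hne hra hrb hab hi hi' hj hj'
  · rintro hcyc ⟨plan, hplan, rfl⟩
    have hstep : ∀ x, ∃ i, x ∈ runPlan S plan ∧ x ∉ S →
        x ∈ runPlan S (plan.take (i + 1)) ∧ x ∉ runPlan S (plan.take i) := by
      intro x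
      by_cases hx : x ∈ runPlan S plan ∧ x ∉ S
      · obtain ⟨i, hi⟩ := exists_step_of_mem_runPlan hx.1 hx.2
        exact ⟨i, fun _ => hi⟩
      · exact ⟨0, fun h => absurd h hx⟩
    choose f hf using hstep
    refine not_hasCycleOn_of_lt f ?_ hcyc
    rintro x hx y hy ⟨hne, ra, hra, rfl, rb, hrb, rfl, hab⟩
    exact hplan.lt_of_precedence hSR hne hra hrb hab (hf _ hx).1 (hf _ hx).2 (hf _ hy).1
      (hf _ hy).2
end
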